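/- Let Ω ⊂ P(ℝ^d) be a properly convex domain, let Λ ⊂ Aut(Ω) be a convex co-compact subgroup, and let C = C_Ω(Λ). Assume every boundary face of Ω which intersects closure(C) has dimension at most one. If S ⊂ C is a properly embedded two-dimensional simplex, then ∂S = ⋃_{x ∈ ∂S} F_Ω(x), i.e. ∂S is a union of open faces of Ω. -/

import Mathlib

open Set Filter

noncomputable section

/-- Real projective space `P(ℝ^d)`, with the quotient topology. -/
abbrev PSpace (d : ℕ) := Projectivization ℝ (Fin d → ℝ)

instance PSpace.instTopologicalSpace (d : ℕ) : TopologicalSpace (PSpace d) :=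
  inferInstanceAs (TopologicalSpace (Quotient (projectivizationSetoid ℝ (Fin d → ℝ))))

namespace Paper

variable {d : ℕ}

/-- Inhomogeneous coordinates in the affine chart determined by the linear functional `f`:
a projective point `[v]` with `f v ≠ 0` is sent to the representative `v / f v` lying in the
affine hyperplane `{f = 1}`. -/
def chartMap (f : (Fin d → ℝ) →ₗ[ℝ] ℝ) (x : PSpace d) : Fin d → ℝ :=
  (f x.rep)⁻¹ • x.rep

/-- A subset of `P(ℝ^d)` is properly convex if there is an affine chart in which it is a
bounded convex set. -/
def IsProperlyConvex (C : Set (PSpace d)) : Prop :=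
  ∃ f : (Fin d → ℝ) →ₗ[ℝ] ℝ, (∀ x ∈ closure C, f x.rep ≠ 0) ∧
    Convex ℝ (chartMap f '' C) ∧ Bornology.IsBounded (chartMap f '' C)

/-- A properly convex domain: an open, nonempty, properly convex subset of `P(ℝ^d)`. -/
def IsPCDomain (Ω : Set (PSpace d)) : Prop :=
  IsOpen Ω ∧ Ω.Nonempty ∧ IsProperlyConvex Ω

open Classical in
/-- A choice of an affine chart containing the properly convex set `C`. -/
def chartOf (C : Set (PSpace d)) : (Fin d → ℝ) →ₗ[ℝ] ℝ :=
  if h : IsProperlyConvex C then h.choose else 0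

/-- The chart map associated to the chosen chart of `C`. -/
def cmap (C : Set (PSpace d)) : PSpace d → Fin d → ℝ := chartMap (chartOf C)

/-- The Hilbert distance between `u` and `v` computed in an affine chart where the convex set
is `O`: writing the line through `u, v` as `t ↦ u + t(v-u)`, with boundary parameters
`tm = inf {t | u + t(v-u) ∈ O} ≤ 0` and `tp = sup {...} ≥ 1`, the cross-ratio
`[a,u,v,b]` of `a = u + tm(v-u), u, v, b = u + tp(v-u)` equals `(tp(1-tm))/((-tm)(tp-1))`. -/
def hilbertDistChart (O : Set (Fin d → ℝ)) (u v : Fin d → ℝ) : ℝ :=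
  if u = v then 0
  else
    (1 / 2) * Real.log
      ((sSup {t : ℝ | u + t • (v - u) ∈ O} * (1 - sInf {t : ℝ | u + t • (v - u) ∈ O})) /
        ((-(sInf {t : ℝ | u + t • (v - u) ∈ O})) * (sSup {t : ℝ | u + t • (v - u) ∈ O} - 1)))

/-- The Hilbert metric of a properly convex set `C` (open in its span). -/
def hilbertDist (C : Set (PSpace d)) (x y : PSpace d) : ℝ :=
  hilbertDistChart (cmap C '' C) (cmap C x) (cmap C y)

/-- The closed projective line segment `[x,y]` contained in `closure C`. -/
def projSeg (C : Set (PSpace d)) (x y : PSpace d) : Set (PSpace d) :=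
  {z ∈ closure C | cmap C z ∈ segment ℝ (cmap C x) (cmap C y)}

/-- The open projective line segment `(x,y)` contained in `closure C`. -/
def projOpenSeg (C : Set (PSpace d)) (x y : PSpace d) : Set (PSpace d) :=
  {z ∈ closure C | cmap C z ∈ openSegment ℝ (cmap C x) (cmap C y)}

/-- The open face `F_C(x)` of a point `x ∈ closure C`: the set `{x}` together with all
`y ∈ closure C` such that some open line segment contained in `closure C` contains
both `x` and `y`. -/
def face (C : Set (PSpace d)) (x : PSpace d) : Set (PSpace d) :=
  insert x {y ∈ closure C | ∃ a ∈ closure C, ∃ b ∈ closure C,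
    x ∈ projOpenSeg C a b ∧ y ∈ projOpenSeg C a b}

/-- The ideal boundary `∂_i C = closure C \ C`. -/
def idealBdry (C : Set (PSpace d)) : Set (PSpace d) := closure C \ C

/-- The dimension of a subset `B`, computed in the chart of the ambient convex set `C`. -/
def pdimIn (C B : Set (PSpace d)) : ℕ :=
  Module.finrank ℝ (affineSpan ℝ (cmap C '' B)).direction

/-- The dimension of a convex subset of `P(ℝ^d)`. -/
def pdim (A : Set (PSpace d)) : ℕ := pdimIn A A

/-- The coarse dimension `cdim_C(A)` of a nonempty subset `A` of a properly convex set `C`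
open in its span: the smallest `k` such that `A` is contained in an `R`-neighborhood (for the
Hilbert metric of `C`) of a `k`-dimensional convex subset `B ⊆ C`. -/
def cdim (C A : Set (PSpace d)) : ℕ :=
  sInf {k : ℕ | ∃ R : ℝ, 0 < R ∧ ∃ B : Set (PSpace d), B ⊆ C ∧
    Convex ℝ (cmap C '' B) ∧ pdimIn C B = k ∧
    A ⊆ {p ∈ C | ∃ q ∈ B, hilbertDist C p q < R}}

/-- The cone over the standard open `(p-1)`-dimensional simplex: vectors whose first `p`
coordinates are positive and whose remaining coordinates vanish. -/
def simplexCone (p : ℕ) : Set (Fin d → ℝ) :=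
  {v | (∀ i : Fin d, (i : ℕ) < p → 0 < v i) ∧ ∀ i : Fin d, p ≤ (i : ℕ) → v i = 0}

/-- `S` is the image under `g ∈ PGL_d(ℝ)` of the standard open simplex with `p` vertices. -/
def IsSimplexWithMap (p : ℕ) (S : Set (PSpace d)) (g : (Fin d → ℝ) ≃ₗ[ℝ] (Fin d → ℝ)) : Prop :=
  S = {q : PSpace d | ∃ v ∈ simplexCone (d := d) p, ∃ hv : v ≠ 0,
        q = Projectivization.mk ℝ (g v) (by simpa using hv)}

/-- `S ⊆ P(ℝ^d)` is a simplex of dimension `k`. -/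
def IsSimplexOfDim (k : ℕ) (S : Set (PSpace d)) : Prop :=
  k + 1 ≤ d ∧ ∃ g : (Fin d → ℝ) ≃ₗ[ℝ] (Fin d → ℝ), IsSimplexWithMap (k + 1) S g

/-- `S` is a simplex with vertices `v 0, …, v (p-1)` (so of dimension `p - 1`). -/
def HasVertices {p : ℕ} (S : Set (PSpace d)) (v : Fin p → PSpace d) : Prop :=
  ∃ (hp : p ≤ d) (g : (Fin d → ℝ) ≃ₗ[ℝ] (Fin d → ℝ)),
    IsSimplexWithMap p S g ∧
    ∀ j : Fin p, v j = Projectivization.mk ℝ (g (Pi.single (Fin.castLE hp j) 1))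
      (by
        simp only [ne_eq, EmbeddingLike.map_eq_zero_iff]
        intro h
        have h1 := congrFun h (Fin.castLE hp j)
        rw [Pi.single_eq_same] at h1
        exact one_ne_zero (α := ℝ) h1)

/-- `A ⊆ B` is properly embedded if the inclusion map `A ↪ B` is proper. -/
def IsProperlyEmbedded (A B : Set (PSpace d)) : Prop :=
  ∃ h : A ⊆ B, IsProperMap (Set.inclusion h)

/-- The projective action of `GL(ℝ^d)` (hence of `PGL_d(ℝ)`) on `P(ℝ^d)`. -/
def pact (g : (Fin d → ℝ) ≃ₗ[ℝ] (Fin d → ℝ)) : PSpace d → PSpace d :=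
  Projectivization.map g.toLinearMap g.injective

/-- A naive convex co-compact triple `(Ω, C, Λ)`. -/
structure NCCTriple (d : ℕ) where
  Ω : Set (PSpace d)
  C : Set (PSpace d)
  Λ : Subgroup ((Fin d → ℝ) ≃ₗ[ℝ] (Fin d → ℝ))
  isOpen_Ω : IsOpen Ω
  nonempty_Ω : Ω.Nonempty
  properlyConvex_Ω : IsProperlyConvex Ω
  inv_Ω : ∀ g ∈ Λ, pact g '' Ω = Ω
  infinite_Λ : (Λ : Set ((Fin d → ℝ) ≃ₗ[ℝ] (Fin d → ℝ))).Infinite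
  discrete_Λ : ∀ K ⊆ Ω, IsCompact K →
    {g : (Fin d → ℝ) ≃ₗ[ℝ] (Fin d → ℝ) | g ∈ Λ ∧ (pact g '' K ∩ K).Nonempty}.Finite
  C_nonempty : C.Nonempty
  C_sub : C ⊆ Ω
  C_closedInΩ : closure C ∩ Ω ⊆ C
  C_convex : Convex ℝ (cmap Ω '' C)
  inv_C : ∀ g ∈ Λ, pact g '' C = C
  cocompact : ∃ K : Set (PSpace d), K ⊆ C ∧ IsCompact K ∧ C ⊆ ⋃ g ∈ Λ, pact g '' K

/-- The orbit of a point under a subgroup of `PGL_d(ℝ)`. -/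
def porbit (Λ : Subgroup ((Fin d → ℝ) ≃ₗ[ℝ] (Fin d → ℝ))) (p : PSpace d) : Set (PSpace d) :=
  {q | ∃ g ∈ Λ, q = pact g p}

/-- The full orbital limit set `L_Ω(Λ)`. -/
def limitSet (Ω : Set (PSpace d)) (Λ : Subgroup ((Fin d → ℝ) ≃ₗ[ℝ] (Fin d → ℝ))) :
    Set (PSpace d) :=
  ⋃ p ∈ Ω, (closure (porbit Λ p) \ porbit Λ p)

/-- The convex hull of `X ⊆ closure Ω` taken inside `Ω`. -/
def convHullIn (Ω X : Set (PSpace d)) : Set (PSpace d) :=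
  {z ∈ Ω | cmap Ω z ∈ convexHull ℝ (cmap Ω '' X)}

/-- `C_Ω(Λ)`: the convex hull of the full orbital limit set in `Ω`. -/
def coreC (Ω : Set (PSpace d)) (Λ : Subgroup ((Fin d → ℝ) ≃ₗ[ℝ] (Fin d → ℝ))) :
    Set (PSpace d) :=
  convHullIn Ω (limitSet Ω Λ)

/-- A convex co-compact group `Λ ⊆ Aut(Ω)`: an infinite discrete subgroup preserving `Ω`
such that `C_Ω(Λ)` is nonempty and `Λ` acts cocompactly on it. -/
structure CCSetup (d : ℕ) where
  Ω : Set (PSpace d)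
  Λ : Subgroup ((Fin d → ℝ) ≃ₗ[ℝ] (Fin d → ℝ))
  isOpen_Ω : IsOpen Ω
  nonempty_Ω : Ω.Nonempty
  properlyConvex_Ω : IsProperlyConvex Ω
  inv_Ω : ∀ g ∈ Λ, pact g '' Ω = Ω
  infinite_Λ : (Λ : Set ((Fin d → ℝ) ≃ₗ[ℝ] (Fin d → ℝ))).Infinite
  discrete_Λ : ∀ K ⊆ Ω, IsCompact K →
    {g : (Fin d → ℝ) ≃ₗ[ℝ] (Fin d → ℝ) | g ∈ Λ ∧ (pact g '' K ∩ K).Nonempty}.Finite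
  core_nonempty : (coreC Ω Λ).Nonempty
  cocompact : ∃ K : Set (PSpace d), K ⊆ coreC Ω Λ ∧ IsCompact K ∧
    coreC Ω Λ ⊆ ⋃ g ∈ Λ, pact g '' K

/-- The Gromov product of `x, y` at `w`, with respect to the Hilbert metric of `Ω`. -/
def gromovProd (Ω : Set (PSpace d)) (w x y : PSpace d) : ℝ :=
  (hilbertDist Ω x w + hilbertDist Ω y w - hilbertDist Ω x y) / 2

/-- `(C, d_Ω)` is Gromov hyperbolic. -/
def GromovHyperbolicOn (Ω C : Set (PSpace d)) : Prop :=
  ∃ δ : ℝ, 0 ≤ δ ∧ ∀ x ∈ C, ∀ y ∈ C, ∀ z ∈ C, ∀ w ∈ C,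
    min (gromovProd Ω w x y) (gromovProd Ω w y z) - δ ≤ gromovProd Ω w x z

/-- The open Hilbert-metric ball in `Ω`. -/
def hBall (Ω : Set (PSpace d)) (x : PSpace d) (r : ℝ) : Set (PSpace d) :=
  {y ∈ Ω | hilbertDist Ω x y < r}

/-- The Hausdorff distance between `A` and `B` (w.r.t. the Hilbert metric of `Ω`)
is less than `ε`. -/
def hausLT (Ω A B : Set (PSpace d)) (ε : ℝ) : Prop :=
  (∀ a ∈ A, ∃ b ∈ B, hilbertDist Ω a b < ε) ∧ ∀ b ∈ B, ∃ a ∈ A, hilbertDist Ω a b < ε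

/-- The Hausdorff distance between `A` and `B` (w.r.t. the Hilbert metric of `Ω`)
is at most `r`. -/
def hausdorffDistLE (Ω A B : Set (PSpace d)) (r : ℝ) : Prop :=
  ∀ ε : ℝ, 0 < ε → hausLT Ω A B (r + ε)

/-- Convergence `F n → C` in the local Hausdorff topology induced by `d_Ω`. -/
def LocalHausConv (Ω : Set (PSpace d)) (F : ℕ → Set (PSpace d)) (C : Set (PSpace d)) : Prop :=
  ∀ x ∈ Ω, ∀ r : ℝ, 0 < r → ∀ ε : ℝ, 0 < ε →
    ∀ᶠ n in atTop, hausLT Ω (F n ∩ hBall Ω x r) (C ∩ hBall Ω x r) ε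

/-- A collection `𝒮` of closed subsets of `Ω` is closed and discrete in the local Hausdorff
topology: any sequence in `𝒮` converging to a nonempty closed subset of `Ω` has limit in `𝒮`
and is eventually equal to its limit. -/
def ClosedAndDiscreteInLHT (Ω : Set (PSpace d)) (𝒮 : Set (Set (PSpace d))) : Prop :=
  ∀ F : ℕ → Set (PSpace d), (∀ n, F n ∈ 𝒮) →
    ∀ C : Set (PSpace d), C.Nonempty → C ⊆ Ω → closure C ∩ Ω ⊆ C → LocalHausConv Ω F C →
      C ∈ 𝒮 ∧ ∀ᶠ n in atTop, F n = C


/-! ### Abstract convex part -/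

/-- Vector-space version of the open face. -/
def Fc {E : Type*} [AddCommGroup E] [Module ℝ E] (D : Set E) (X : E) : Set E :=
  {Y | Y ∈ D ∧ ∃ ε : ℝ, 0 < ε ∧ X + ε • (X - Y) ∈ D ∧ Y + ε • (Y - X) ∈ D}

section abs
variable {E : Type*} [AddCommGroup E] [Module ℝ E] {D : Set E}

lemma mem_shrink (hD : Convex ℝ D) {X Y : E} (hX : X ∈ D) {ε δ : ℝ} (hδ : 0 ≤ δ) (hδε : δ ≤ ε)
    (h : X + ε • (X - Y) ∈ D) : X + δ • (X - Y) ∈ D := by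
  rcases eq_or_lt_of_le (hδ.trans hδε) with h0 | h0
  · have : δ = ε := by linarith
    rwa [this]
  · have := hD.add_smul_mem hX h (t := δ / ε) ⟨by positivity, (div_le_one h0).2 hδε⟩
    rwa [smul_smul, div_mul_cancel₀ _ h0.ne'] at this

lemma self_mem_Fc {X : E} (hX : X ∈ D) : X ∈ Fc D X :=
  ⟨hX, 1, one_pos, by simpa using hX, by simpa using hX⟩

lemma Fc_convex (hD : Convex ℝ D) {X : E} (hX : X ∈ D) : Convex ℝ (Fc D X) := by
  rintro Y ⟨hY, ε, hε, h1, h2⟩ Z ⟨hZ, δ, hδ, h3, h4⟩ a b ha hb hab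
  refine ⟨hD hY hZ ha hb hab, min ε δ, lt_min hε hδ, ?_, ?_⟩
  · have e1 := mem_shrink hD hX (lt_min hε hδ).le (min_le_left _ _) h1
    have e2 := mem_shrink hD hX (lt_min hε hδ).le (min_le_right _ _) h3
    have := hD e1 e2 ha hb hab
    convert this using 1
    obtain rfl : b = 1 - a := by linarith
    module
  · have e1 := mem_shrink hD hY (lt_min hε hδ).le (min_le_left _ _) h2
    have e2 := mem_shrink hD hZ (lt_min hε hδ).le (min_le_right _ _) h4
    have := hD e1 e2 ha hb hab
    convert this using 1
    obtain rfl : b = 1 - a := by linarith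
    module

/-- From segments to the epsilon version. -/
lemma Fc_of_seg (hD : Convex ℝ D) {X Y a b : E} (ha : a ∈ D) (hb : b ∈ D)
    (hX : X ∈ openSegment ℝ a b) (hY : Y ∈ openSegment ℝ a b) : Y ∈ Fc D X := by
  have hYD : Y ∈ D := hD.openSegment_subset ha hb hY
  rw [openSegment_eq_image'] at hX hY
  obtain ⟨s, ⟨hs0, hs1⟩, rfl⟩ := hX
  obtain ⟨t, ⟨ht0, ht1⟩, rfl⟩ := hY
  set ε := min (min s (1 - s)) (min t (1 - t)) with hεd
  have e1 : ε ≤ s := (min_le_left _ _).trans (min_le_left _ _)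
  have e2 : ε ≤ 1 - s := (min_le_left _ _).trans (min_le_right _ _)
  have e3 : ε ≤ t := (min_le_right _ _).trans (min_le_left _ _)
  have e4 : ε ≤ 1 - t := (min_le_right _ _).trans (min_le_right _ _)
  have e0 : 0 < ε := by
    refine lt_min (lt_min hs0 (by linarith)) (lt_min ht0 (by linarith))
  have key : ∀ r : ℝ, 0 ≤ r → r ≤ 1 → a + r • (b - a) ∈ D := fun r h0 h1 => by
    have := hD ha hb (a := 1 - r) (b := r) (by linarith) h0 (by ring)
    convert this using 1
    module
  refine ⟨hYD, ε, e0, ?_, ?_⟩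
  · have := key (s + ε * (s - t)) (by nlinarith) (by nlinarith)
    convert this using 1
    module
  · have := key (t + ε * (t - s)) (by nlinarith) (by nlinarith)
    convert this using 1
    module

lemma seg_of_Fc {X Y : E} (h : Y ∈ Fc D X) : ∃ a ∈ D, ∃ b ∈ D,
    X ∈ openSegment ℝ a b ∧ Y ∈ openSegment ℝ a b := by
  obtain ⟨hY, ε, hε, h1, h2⟩ := h
  have hp : (0:ℝ) < 1 + 2 * ε := by linarith
  refine ⟨_, h1, _, h2, ⟨(1 + ε) / (1 + 2 * ε), ε / (1 + 2 * ε), by positivity, by positivity,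
    by field_simp; ring, ?_⟩, ⟨ε / (1 + 2 * ε), (1 + ε) / (1 + 2 * ε), by positivity, by positivity,
    by field_simp; ring, ?_⟩⟩
  · match_scalars <;> field_simp <;> ring
  · match_scalars <;> field_simp <;> ring

/-- combining: if `Y ∈ Fc u` then `mid(Y,v) ∈ Fc (mid(u,v))` -/
lemma mid_mem_Fc (hD : Convex ℝ D) {u v Y : E} (hv : v ∈ D) (hY : Y ∈ Fc D u) :
    (1 / 2 : ℝ) • Y + (1 / 2 : ℝ) • v ∈ Fc D ((1 / 2 : ℝ) • u + (1 / 2 : ℝ) • v) := by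
  obtain ⟨hY, ε, hε, h1, h2⟩ := hY
  have hh : (0:ℝ) ≤ 1 / 2 := by norm_num
  refine ⟨hD hY hv hh hh (by norm_num), ε, hε, ?_, ?_⟩
  · convert hD h1 hv hh hh (by norm_num) using 1; module
  · convert hD h2 hv hh hh (by norm_num) using 1; module

/-- Boundary of the triangle. -/
def Bd (u : Fin 3 → E) : Set E :=
  {X | ∃ w : Fin 3 → ℝ, (∀ i, 0 ≤ w i) ∧ ∑ i, w i = 1 ∧ (∃ i, w i = 0) ∧ X = ∑ i, w i • u i}

lemma seg_mem_Bd (u : Fin 3 → E) {i j : Fin 3} (hij : i ≠ j) {s t : ℝ} (hs : 0 ≤ s) (ht : 0 ≤ t)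
    (hst : s + t = 1) : s • u i + t • u j ∈ Bd u := by
  refine ⟨fun k => if k = i then s else if k = j then t else 0, ?_, ?_, ?_, ?_⟩
  · intro k; dsimp only; split_ifs <;> first | assumption | exact le_rfl
  · fin_cases i <;> fin_cases j <;> simp_all [Fin.sum_univ_three] <;> linarith
  · fin_cases i <;> fin_cases j <;> simp_all [Fin.exists_fin_succ]
  · fin_cases i <;> fin_cases j <;> simp_all [Fin.sum_univ_three] <;> abel

lemma Bd_cases (u : Fin 3 → E) {X : E} (hX : X ∈ Bd u) : ∃ i j : Fin 3, i ≠ j ∧ ∃ s t : ℝ,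
    0 ≤ s ∧ 0 ≤ t ∧ s + t = 1 ∧ X = s • u i + t • u j := by
  obtain ⟨w, hw, hs, ⟨i, hi⟩, rfl⟩ := hX
  rw [Fin.sum_univ_three] at hs ⊢
  fin_cases i
  · exact ⟨1, 2, by decide, w 1, w 2, hw _, hw _, by simp_all, by simp_all⟩
  · exact ⟨0, 2, by decide, w 0, w 2, hw _, hw _, by simp_all, by simp_all⟩
  · exact ⟨0, 1, by decide, w 0, w 1, hw _, hw _, by simp_all, by simp_all⟩

/-- points in the face of an interior point of an edge are in the span -/
lemma span_of_edge (hD : Convex ℝ D) {u : Fin 3 → E} (hu : LinearIndependent ℝ u)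
    (huD : ∀ i, u i ∈ D)
    (H : ∀ X ∈ Bd u, ∀ P ∈ Fc D X, ∀ Q ∈ Fc D X, ∀ R ∈ Fc D X, ¬ LinearIndependent ℝ ![P, Q, R])
    {i j : Fin 3} (hij : i ≠ j) {s t : ℝ} (hs : 0 < s) (ht : 0 < t) (hst : s + t = 1) {Y : E}
    (hY : Y ∈ Fc D (s • u i + t • u j)) : ∃ p q : ℝ, Y = p • u i + q • u j := by
  have hX := seg_mem_Bd u hij hs.le ht.le hst
  have hXo : s • u i + t • u j ∈ openSegment ℝ (u i) (u j) := ⟨s, t, hs, ht, hst, rfl⟩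
  have hP : (1/2 : ℝ) • u i + (1/2 : ℝ) • u j ∈ Fc D (s • u i + t • u j) :=
    Fc_of_seg hD (huD i) (huD j) hXo ⟨1/2, 1/2, by norm_num, by norm_num, by norm_num, rfl⟩
  have hQ : (1/3 : ℝ) • u i + (2/3 : ℝ) • u j ∈ Fc D (s • u i + t • u j) :=
    Fc_of_seg hD (huD i) (huD j) hXo ⟨1/3, 2/3, by norm_num, by norm_num, by norm_num, rfl⟩
  have hn := H _ hX _ hY _ hP _ hQ
  have hpair : LinearIndependent ℝ ![(1/2 : ℝ) • u i + (1/2 : ℝ) • u j,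
      (1/3 : ℝ) • u i + (2/3 : ℝ) • u j] := by
    have h2 : LinearIndependent ℝ ![u i, u j] := by
      have := hu.comp ![i, j] (by
        intro a b; fin_cases a <;> fin_cases b <;> simp_all [Ne.symm])
      convert this using 1
      ext k; fin_cases k <;> rfl
    rw [LinearIndependent.pair_iff] at h2 ⊢
    intro a b hab
    have := h2 (a / 2 + b / 3) (a / 2 + 2 * b / 3) (by rw [← hab]; module)
    constructor <;> linarith [this.1, this.2]
  have hmem : Y ∈ Submodule.span ℝ (Set.range ![(1/2 : ℝ) • u i + (1/2 : ℝ) • u j,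
      (1/3 : ℝ) • u i + (2/3 : ℝ) • u j]) := by
    by_contra hc
    exact hn (linearIndependent_finCons.2 ⟨hpair, hc⟩)
  rw [Matrix.range_cons, Matrix.range_cons, Matrix.range_empty, Set.union_empty,
    Set.singleton_union, Submodule.mem_span_pair] at hmem
  obtain ⟨a, b, rfl⟩ := hmem
  exact ⟨a / 2 + b / 3, a / 2 + 2 * b / 3, by module⟩

lemma vertex_face (hD : Convex ℝ D) {f : E →ₗ[ℝ] ℝ} (hf : ∀ x ∈ D, f x = 1)
    {u : Fin 3 → E} (hu : LinearIndependent ℝ u)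
    (huD : ∀ i, u i ∈ D)
    (H : ∀ X ∈ Bd u, ∀ P ∈ Fc D X, ∀ Q ∈ Fc D X, ∀ R ∈ Fc D X, ¬ LinearIndependent ℝ ![P, Q, R])
    (i : Fin 3) {Y : E} (hY : Y ∈ Fc D (u i)) : Y = u i := by
  have key : ∀ j, i ≠ j → ∃ p q : ℝ, Y = p • u i + q • u j := by
    intro j hij
    obtain ⟨p, q, h⟩ := span_of_edge hD hu huD H hij (s := 1/2) (t := 1/2) (by norm_num)
      (by norm_num) (by norm_num) (mid_mem_Fc hD (huD j) hY)
    refine ⟨2 * p, 2 * q - 1, ?_⟩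
    have : Y = (2 : ℝ) • ((1 / 2 : ℝ) • Y + (1 / 2 : ℝ) • u j) - u j := by module
    rw [this, h]; module
  obtain ⟨j, k, hij, hik, hjk⟩ : ∃ j k : Fin 3, i ≠ j ∧ i ≠ k ∧ j ≠ k := by
    have : ∀ i : Fin 3, ∃ j k : Fin 3, i ≠ j ∧ i ≠ k ∧ j ≠ k := by decide
    exact this i
  obtain ⟨p, q, h1⟩ := key j hij
  obtain ⟨p', q', h2⟩ := key k hik
  have hl : LinearIndependent ℝ (u ∘ ![i, j, k]) := hu.comp ![i, j, k] (by
    intro a b; fin_cases a <;> fin_cases b <;> simp_all [Ne.symm])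
  rw [Fintype.linearIndependent_iff] at hl
  have := hl ![p - p', q, -q'] (by
    simp [Fin.sum_univ_three]
    have : p • u i + q • u j - (p' • u i + q' • u k) = 0 := by rw [← h1, ← h2]; simp
    rw [← this]; module) 1
  simp at this
  subst this
  have h3 := hf _ hY.1
  rw [h1] at h3 ⊢
  simp [hf _ (huD i)] at h3
  simp [h3]

theorem Bd_union (hD : Convex ℝ D) {f : E →ₗ[ℝ] ℝ} (hf : ∀ x ∈ D, f x = 1)
    {u : Fin 3 → E} (hu : LinearIndependent ℝ u)
    (huD : ∀ i, u i ∈ D)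
    (H : ∀ X ∈ Bd u, ∀ P ∈ Fc D X, ∀ Q ∈ Fc D X, ∀ R ∈ Fc D X, ¬ LinearIndependent ℝ ![P, Q, R])
    {X Y : E} (hX : X ∈ Bd u) (hY : Y ∈ Fc D X) : Y ∈ Bd u := by
  -- no point of the face lies strictly beyond a vertex
  have beyond : ∀ i j : Fin 3, i ≠ j → ∀ s t : ℝ, 0 < s → 0 < t → s + t = 1 →
      ∀ p q : ℝ, p + q = 1 → Y = p • u i + q • u j → X = s • u i + t • u j → 0 ≤ p := by
    intro i j hij s t hs ht hst p q hpq hYe hXe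
    by_contra! hp
    obtain ⟨a, ha, b, hb, hXs, hYs⟩ := seg_of_Fc hY
    have hd : 0 < s - p := by linarith
    have hm : u j ∈ openSegment ℝ X Y := by
      refine ⟨-p / (s - p), s / (s - p), div_pos (by linarith) hd, div_pos hs hd,
        by field_simp; ring, ?_⟩
      obtain rfl : t = 1 - s := by linarith
      obtain rfl : q = 1 - p := by linarith
      rw [hXe, hYe]
      match_scalars <;> field_simp <;> ring
    have hm2 : u j ∈ openSegment ℝ a b := (convex_openSegment a b).openSegment_subset hXs hYs hm
    have hXj := vertex_face hD hf hu huD H j (Fc_of_seg hD ha hb hm2 hXs)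
    rw [Fintype.linearIndependent_iff] at hu
    have h0 : s • u i + (t - 1) • u j = 0 := by
      have : s • u i + t • u j - u j = 0 := by rw [← hXe, hXj, sub_self]
      rw [← this]; module
    have := hu (fun k => if k = i then s else if k = j then t - 1 else 0) (by
      rw [← h0]
      clear * - hij
      fin_cases i <;> fin_cases j <;> simp_all [Fin.sum_univ_three] <;> abel) i
    simp at this
    linarith
  obtain ⟨i, j, hij, s, t, hs, ht, hst, hXe⟩ := Bd_cases u hX
  rcases eq_or_lt_of_le hs with rfl | hs
  · obtain rfl : t = 1 := by linarith
    have : X = u j := by simp [hXe]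
    subst this
    rwa [vertex_face hD hf hu huD H j hY]
  rcases eq_or_lt_of_le ht with rfl | ht
  · obtain rfl : s = 1 := by linarith
    have : X = u i := by simp [hXe]
    subst this
    rwa [vertex_face hD hf hu huD H i hY]
  obtain ⟨p, q, hYe⟩ := span_of_edge hD hu huD H hij hs ht hst (hXe ▸ hY)
  have hpq : p + q = 1 := by
    have := hf _ hY.1
    rw [hYe] at this
    simpa [hf _ (huD i), hf _ (huD j)] using this
  rw [hYe]
  refine seg_mem_Bd u hij (beyond i j hij s t hs ht hst p q hpq hYe hXe)
    (beyond j i hij.symm t s ht hs (by linarith) q p (by linarith) ?_ ?_) hpq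
  · rw [hYe, add_comm]
  · rw [hXe, add_comm]

end abs

/-! ### Topology of projective space -/

section topo

lemma isOpenQuotientMap_mk' :
    IsOpenQuotientMap (fun v : {v : Fin d → ℝ // v ≠ 0} => (Projectivization.mk' ℝ v : PSpace d)) := by
  have hq : Topology.IsQuotientMap
      (fun v : {v : Fin d → ℝ // v ≠ 0} => (Projectivization.mk' ℝ v : PSpace d)) :=
    isQuotientMap_quot_mk
  refine ⟨hq.surjective, hq.continuous, ?_⟩
  intro U hU
  rw [← hq.isOpen_preimage]
  have : (fun v : {v : Fin d → ℝ // v ≠ 0} => (Projectivization.mk' ℝ v : PSpace d)) ⁻¹'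
      ((fun v : {v : Fin d → ℝ // v ≠ 0} => (Projectivization.mk' ℝ v : PSpace d)) '' U) =
      ⋃ a : ℝˣ, (fun v : {v : Fin d → ℝ // v ≠ 0} =>
        (⟨a • v.1, (smul_ne_zero_iff_ne a).2 v.2⟩ : {v : Fin d → ℝ // v ≠ 0})) ⁻¹' U := by
    ext v
    simp only [mem_preimage, mem_image, mem_iUnion, Projectivization.mk'_eq_mk]
    constructor
    · rintro ⟨w, hw, h⟩
      obtain ⟨a, ha⟩ := (Projectivization.mk_eq_mk_iff ℝ _ _ w.2 v.2).1 h
      refine ⟨a, ?_⟩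
      convert hw
    · rintro ⟨a, ha⟩
      exact ⟨_, ha, (Projectivization.mk_eq_mk_iff ℝ _ _ _ v.2).2 ⟨a, rfl⟩⟩
  rw [this]
  refine isOpen_iUnion fun a => hU.preimage ?_
  exact Continuous.subtype_mk (continuous_subtype_val.const_smul a) _

lemma chartMap_mk (f : (Fin d → ℝ) →ₗ[ℝ] ℝ) (v : Fin d → ℝ) (hv : v ≠ 0) :
    chartMap f (Projectivization.mk ℝ v hv) = (f v)⁻¹ • v := by
  obtain ⟨a, ha⟩ := Projectivization.exists_smul_eq_mk_rep ℝ v hv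
  unfold chartMap
  rw [← ha, Units.smul_def, map_smul, smul_smul, smul_eq_mul, mul_inv]
  congr 1
  have := a.ne_zero
  field_simp

lemma f_rep_mk (f : (Fin d → ℝ) →ₗ[ℝ] ℝ) (v : Fin d → ℝ) (hv : v ≠ 0) :
    f (Projectivization.mk ℝ v hv).rep ≠ 0 ↔ f v ≠ 0 := by
  obtain ⟨a, ha⟩ := Projectivization.exists_smul_eq_mk_rep ℝ v hv
  rw [← ha, Units.smul_def, map_smul, smul_eq_mul]
  simp

lemma f_chartMap {f : (Fin d → ℝ) →ₗ[ℝ] ℝ} {x : PSpace d} (hx : f x.rep ≠ 0) :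
    f (chartMap f x) = 1 := by
  simp [chartMap, hx]

lemma ne_zero_of_f {f : (Fin d → ℝ) →ₗ[ℝ] ℝ} {v : Fin d → ℝ} (h : f v = 1) : v ≠ 0 := by
  rintro rfl; simp at h

lemma mk_chartMap {f : (Fin d → ℝ) →ₗ[ℝ] ℝ} {x : PSpace d} (hx : f x.rep ≠ 0)
    (h : chartMap f x ≠ 0) : Projectivization.mk ℝ (chartMap f x) h = x := by
  conv_rhs => rw [← Projectivization.mk_rep x]
  rw [Projectivization.mk_eq_mk_iff']
  exact ⟨_, rfl⟩

lemma chartMap_inj {f : (Fin d → ℝ) →ₗ[ℝ] ℝ} {x y : PSpace d} (hx : f x.rep ≠ 0)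
    (hy : f y.rep ≠ 0) (h : chartMap f x = chartMap f y) : x = y := by
  rw [← mk_chartMap hx (ne_zero_of_f (f_chartMap hx)), ← mk_chartMap hy (ne_zero_of_f (f_chartMap hy))]
  congr 1

lemma chartMap_continuousAt {f : (Fin d → ℝ) →ₗ[ℝ] ℝ} {x : PSpace d} (hx : f x.rep ≠ 0) :
    ContinuousAt (chartMap f) x := by
  obtain ⟨v, rfl⟩ := isOpenQuotientMap_mk'.surjective x
  rw [← isOpenQuotientMap_mk'.continuousAt_comp_iff]
  have : (chartMap f ∘ fun v : {v : Fin d → ℝ // v ≠ 0} => (Projectivization.mk' ℝ v : PSpace d))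
      = fun v => (f v.1)⁻¹ • v.1 := by
    ext1 v
    exact chartMap_mk f v.1 v.2
  rw [this]
  have hfc : Continuous f := f.continuous_of_finiteDimensional
  have hv : f v.1 ≠ 0 := (f_rep_mk f v.1 v.2).1 hx
  exact ((hfc.comp continuous_subtype_val).continuousAt.inv₀ hv).smul
    continuous_subtype_val.continuousAt

lemma mk_mem_closure {A : Set (Fin d → ℝ)} {C : Set (PSpace d)}
    (hA : ∀ v ∈ A, ∃ hv : v ≠ 0, Projectivization.mk ℝ v hv ∈ C) {u : Fin d → ℝ} (hu : u ≠ 0)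
    (huA : u ∈ closure A) : Projectivization.mk ℝ u hu ∈ closure C := by
  let s : Set {v : Fin d → ℝ // v ≠ 0} := {v | v.1 ∈ A}
  have h1 : (⟨u, hu⟩ : {v : Fin d → ℝ // v ≠ 0}) ∈ closure s := by
    rw [closure_subtype]
    refine closure_mono ?_ huA
    intro v hv
    exact ⟨⟨v, (hA v hv).1⟩, hv, rfl⟩
  exact map_mem_closure isOpenQuotientMap_mk'.continuous h1 (fun v hv => (hA v.1 hv).2)

lemma chart_image_closure {f : (Fin d → ℝ) →ₗ[ℝ] ℝ} {C : Set (PSpace d)}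
    (hf : ∀ x ∈ closure C, f x.rep ≠ 0) :
    chartMap f '' closure C = closure (chartMap f '' C) := by
  apply Subset.antisymm
  · rintro _ ⟨x, hx, rfl⟩
    exact mem_closure_image (chartMap_continuousAt (hf x hx)) hx
  · intro u hu
    have hfc : Continuous f := f.continuous_of_finiteDimensional
    have h1 : f u = 1 := by
      have hc : IsClosed {u | f u = 1} := isClosed_eq hfc continuous_const
      refine closure_minimal ?_ hc hu
      rintro _ ⟨x, hx, rfl⟩
      exact f_chartMap (hf x (subset_closure hx))
    refine ⟨Projectivization.mk ℝ u (ne_zero_of_f h1), mk_mem_closure ?_ _ hu, ?_⟩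
    · rintro _ ⟨x, hx, rfl⟩
      have hx' := hf x (subset_closure hx)
      exact ⟨ne_zero_of_f (f_chartMap hx'), by rwa [mk_chartMap hx']⟩
    · rw [chartMap_mk, h1]; simp

lemma chartOf_spec {C : Set (PSpace d)} (h : IsProperlyConvex C) :
    (∀ x ∈ closure C, (chartOf C) x.rep ≠ 0) ∧
    Convex ℝ (cmap C '' C) ∧ Bornology.IsBounded (cmap C '' C) := by
  unfold cmap chartOf
  rw [dif_pos h]
  exact h.choose_spec

lemma pact_mk (g : (Fin d → ℝ) ≃ₗ[ℝ] (Fin d → ℝ)) (v : Fin d → ℝ) (hv : v ≠ 0) :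
    pact g (Projectivization.mk ℝ v hv) = Projectivization.mk ℝ (g v) (by simpa using hv) := rfl

lemma pact_continuous (g : (Fin d → ℝ) ≃ₗ[ℝ] (Fin d → ℝ)) : Continuous (pact g) := by
  rw [← isOpenQuotientMap_mk'.continuous_comp_iff]
  have hg : Continuous g := g.toLinearMap.continuous_of_finiteDimensional
  have : Continuous (fun v : {v : Fin d → ℝ // v ≠ 0} =>
      (⟨g v.1, by simpa using v.2⟩ : {v : Fin d → ℝ // v ≠ 0})) :=
    Continuous.subtype_mk (hg.comp continuous_subtype_val) _
  exact isOpenQuotientMap_mk'.continuous.comp this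

lemma pact_mul (g h : (Fin d → ℝ) ≃ₗ[ℝ] (Fin d → ℝ)) (x : PSpace d) :
    pact (g * h) x = pact g (pact h x) := by
  induction x using Projectivization.ind with
  | h v hv => rfl

lemma pact_one (x : PSpace d) : pact 1 x = x := by
  induction x using Projectivization.ind with
  | h v hv => rfl

lemma chartMap_pact (f : (Fin d → ℝ) →ₗ[ℝ] ℝ) (g : (Fin d → ℝ) ≃ₗ[ℝ] (Fin d → ℝ)) {x : PSpace d}
    (hx : f x.rep ≠ 0) :
    chartMap f (pact g x) = (f (g (chartMap f x)))⁻¹ • g (chartMap f x) := by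
  conv_lhs => rw [← mk_chartMap hx (ne_zero_of_f (f_chartMap hx)), pact_mk, chartMap_mk]

lemma sign_const {E : Type*} [AddCommGroup E] [Module ℝ E] {D : Set E} (hD : Convex ℝ D)
    (h : E →ₗ[ℝ] ℝ) (hne : ∀ x ∈ D, h x ≠ 0) {x y : E} (hx : x ∈ D) (hy : y ∈ D) :
    0 < h x * h y := by
  by_contra! hc
  have hx0 := hne x hx
  have hy0 := hne y hy
  have hlt : h x * h y < 0 := lt_of_le_of_ne hc (mul_ne_zero hx0 hy0)
  have hp : 0 < |h x| + |h y| := by positivity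
  have := hD hx hy (a := |h y| / (|h x| + |h y|)) (b := |h x| / (|h x| + |h y|))
    (by positivity) (by positivity) (by field_simp; ring)
  apply hne _ this
  simp only [map_add, map_smul, smul_eq_mul]
  rcases mul_neg_iff.1 hlt with ⟨h1, h2⟩ | ⟨h1, h2⟩
  · rw [abs_of_pos h1, abs_of_neg h2]; ring
  · rw [abs_of_neg h1, abs_of_pos h2]; ring

end topo

section core

lemma closure_inv (T : CCSetup d) {g : (Fin d → ℝ) ≃ₗ[ℝ] (Fin d → ℝ)} (hg : g ∈ T.Λ)
    {x : PSpace d} (hx : x ∈ closure T.Ω) : pact g x ∈ closure T.Ω :=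
  map_mem_closure (pact_continuous g) hx (fun y hy => T.inv_Ω g hg ▸ mem_image_of_mem _ hy)

lemma limitSet_inv (T : CCSetup d) {g : (Fin d → ℝ) ≃ₗ[ℝ] (Fin d → ℝ)} (hg : g ∈ T.Λ)
    {x : PSpace d} (hx : x ∈ limitSet T.Ω T.Λ) : pact g x ∈ limitSet T.Ω T.Λ := by
  simp only [limitSet, mem_iUnion] at hx ⊢
  obtain ⟨p, hp, hx1, hx2⟩ := hx
  refine ⟨p, hp, map_mem_closure (pact_continuous g) hx1 ?_, ?_⟩
  · rintro _ ⟨h, hh, rfl⟩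
    exact ⟨g * h, mul_mem hg hh, (pact_mul _ _ _).symm⟩
  · rintro ⟨h, hh, he⟩
    refine hx2 ⟨g⁻¹ * h, mul_mem (inv_mem hg) hh, ?_⟩
    rw [pact_mul, ← he, ← pact_mul, inv_mul_cancel, pact_one]

lemma limitSet_sub (T : CCSetup d) : limitSet T.Ω T.Λ ⊆ closure T.Ω := by
  simp only [limitSet]
  refine iUnion₂_subset fun p hp => ?_
  refine sdiff_subset.trans (closure_mono ?_)
  rintro _ ⟨g, hg, rfl⟩
  exact T.inv_Ω g hg ▸ mem_image_of_mem _ hp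

lemma convex_D {Ω : Set (PSpace d)} (h : IsProperlyConvex Ω) : Convex ℝ (cmap Ω '' closure Ω) := by
  obtain ⟨h1, h2, h3⟩ := chartOf_spec h
  unfold cmap at *
  rw [chart_image_closure h1]
  exact h2.closure

lemma core_inv (T : CCSetup d) {g : (Fin d → ℝ) ≃ₗ[ℝ] (Fin d → ℝ)} (hg : g ∈ T.Λ)
    {x : PSpace d} (hx : x ∈ coreC T.Ω T.Λ) : pact g x ∈ coreC T.Ω T.Λ := by
  obtain ⟨h1, -, -⟩ := chartOf_spec T.properlyConvex_Ω
  have hD := convex_D T.properlyConvex_Ω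
  obtain ⟨hxΩ, hxc⟩ := hx
  refine ⟨T.inv_Ω g hg ▸ mem_image_of_mem _ hxΩ, ?_⟩
  set f := chartOf T.Ω with hf
  set h : (Fin d → ℝ) →ₗ[ℝ] ℝ := f ∘ₗ g.toLinearMap with hh
  have hne : ∀ X ∈ cmap T.Ω '' closure T.Ω, h X ≠ 0 := by
    rintro _ ⟨y, hy, rfl⟩
    have e1 := h1 _ (closure_inv T hg hy)
    rw [← mk_chartMap (h1 y hy) (ne_zero_of_f (f_chartMap (h1 y hy))), pact_mk, f_rep_mk] at e1
    exact e1
  set L := cmap T.Ω '' limitSet T.Ω T.Λ with hL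
  have hsub : convexHull ℝ L ⊆ {X | X ∈ cmap T.Ω '' closure T.Ω ∧
      (h X)⁻¹ • g X ∈ convexHull ℝ L} := by
    apply convexHull_min
    · rintro _ ⟨y, hy, rfl⟩
      refine ⟨mem_image_of_mem _ (limitSet_sub T hy), subset_convexHull ℝ _ ?_⟩
      exact ⟨_, limitSet_inv T hg hy, chartMap_pact f g (h1 y (limitSet_sub T hy))⟩
    · rintro X ⟨hX, hX'⟩ Y ⟨hY, hY'⟩ a b ha hb hab
      have hZ := hD hX hY ha hb hab
      refine ⟨hZ, ?_⟩
      have n1 := hne _ hX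
      have n2 := hne _ hY
      have n3 := hne _ hZ
      have p1 := sign_const hD h hne hX hZ
      have p2 := sign_const hD h hne hY hZ
      have := convex_convexHull ℝ L hX' hY' (a := a * (h X / h (a • X + b • Y)))
        (b := b * (h Y / h (a • X + b • Y)))
        (mul_nonneg ha (by rcases mul_pos_iff.1 p1 with ⟨_, _⟩ | ⟨_, _⟩
                           · positivity
                           · exact (div_pos_of_neg_of_neg ‹_› ‹_›).le))
        (mul_nonneg hb (by rcases mul_pos_iff.1 p2 with ⟨_, _⟩ | ⟨_, _⟩
                           · positivity
                           · exact (div_pos_of_neg_of_neg ‹_› ‹_›).le))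
        (by field_simp; simp [smul_eq_mul])
      convert this using 1
      have hgZ : g (a • X + b • Y) = a • g X + b • g Y := by rw [map_add, map_smul, map_smul]
      rw [hgZ]
      generalize h (a • X + b • Y) = z at *
      match_scalars <;> field_simp
  have := (hsub hxc).2
  rw [show cmap T.Ω (pact g x) = _ from chartMap_pact f g (h1 x (subset_closure hxΩ))]
  exact this

lemma core_closed (T : CCSetup d) {x : PSpace d} (hx : x ∈ T.Ω)
    (hxc : x ∈ closure (coreC T.Ω T.Λ)) : x ∈ coreC T.Ω T.Λ := by
  obtain ⟨h1, -, -⟩ := chartOf_spec T.properlyConvex_Ω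
  obtain ⟨K, hK, hKc, hcov⟩ := T.cocompact
  have : LocallyCompactSpace {v : Fin d → ℝ // v ≠ 0} :=
    (isOpen_ne (x := (0 : Fin d → ℝ))).locallyCompactSpace
  have : LocallyCompactSpace (PSpace d) := isOpenQuotientMap_mk'.locallyCompactSpace
  obtain ⟨N, hNx, hNΩ, hNc⟩ := local_compact_nhds (T.isOpen_Ω.mem_nhds hx)
  have hKΩ : K ⊆ T.Ω := fun y hy => (hK hy).1
  have hfin := T.discrete_Λ (K ∪ N) (union_subset hKΩ hNΩ) (hKc.union hNc)
  set G := {g : (Fin d → ℝ) ≃ₗ[ℝ] (Fin d → ℝ) | g ∈ T.Λ ∧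
    (pact g '' (K ∪ N) ∩ (K ∪ N)).Nonempty} with hG
  set M := ⋃ g ∈ G, pact g '' K with hM
  have hMc : IsCompact M := hfin.isCompact_biUnion fun g _ => hKc.image (pact_continuous g)
  have hMcore : M ⊆ coreC T.Ω T.Λ := by
    refine iUnion₂_subset fun g hg => ?_
    rintro _ ⟨k, hk, rfl⟩
    exact core_inv T hg.1 (hK hk)
  have hxM : x ∈ closure M := by
    have : x ∈ closure (N ∩ coreC T.Ω T.Λ) := by
      rw [mem_closure_iff_nhds] at hxc ⊢
      intro t ht
      obtain ⟨y, ⟨hy1, hy2⟩, hy3⟩ := hxc _ (inter_mem ht hNx)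
      exact ⟨y, hy1, hy2, hy3⟩
    refine closure_mono ?_ this
    rintro y ⟨hyN, hyc⟩
    obtain ⟨g, hg, k, hk, rfl⟩ := by simpa using hcov hyc
    exact mem_iUnion₂.2 ⟨g, ⟨hg, _, mem_image_of_mem _ (Or.inl hk), Or.inr hyN⟩, k, hk, rfl⟩
  have hcont : ContinuousOn (chartMap (chartOf T.Ω)) M := fun y hy =>
    (chartMap_continuousAt (h1 y (subset_closure (hMcore hy).1))).continuousWithinAt
  have hcl := (hMc.image_of_continuousOn hcont).isClosed
  have : chartMap (chartOf T.Ω) x ∈ chartMap (chartOf T.Ω) '' M := by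
    rw [← hcl.closure_eq]
    exact mem_closure_image
      (chartMap_continuousAt (h1 x (subset_closure hx))) hxM
  obtain ⟨y, hy, he⟩ := this
  have := chartMap_inj (h1 y (subset_closure (hMcore hy).1)) (h1 x (subset_closure hx)) he
  exact this ▸ hMcore hy

lemma bdry_sub (T : CCSetup d) {S : Set (PSpace d)} (hSsub : S ⊆ coreC T.Ω T.Λ)
    (hSpe : IsProperlyEmbedded S (coreC T.Ω T.Λ)) {x : PSpace d} (hx : x ∈ closure S \ S) :
    x ∈ closure T.Ω \ T.Ω := by
  refine ⟨closure_mono (fun y hy => (hSsub hy).1) hx.1, fun hxΩ => hx.2 ?_⟩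
  have hxc := core_closed T hxΩ (closure_mono hSsub hx.1)
  obtain ⟨h, hp⟩ := hSpe
  have hcl : IsClosed (range (Set.inclusion h)) := hp.isClosedMap.isClosed_range
  have : (⟨x, hxc⟩ : coreC T.Ω T.Λ) ∈ closure (range (Set.inclusion h)) := by
    rw [closure_subtype]
    refine closure_mono ?_ hx.1
    intro y hy
    exact ⟨⟨y, h hy⟩, ⟨⟨y, hy⟩, rfl⟩, rfl⟩
  rw [hcl.closure_eq] at this
  obtain ⟨⟨y, hy⟩, he⟩ := this
  have : y = x := congrArg Subtype.val he
  exact this ▸ hy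

end core

section simplex

lemma exists_G {S : Set (PSpace d)} (hS : IsSimplexOfDim 2 S) :
    ∃ G : Fin 3 → (Fin d → ℝ), LinearIndependent ℝ G ∧
      S = {q | ∃ w : Fin 3 → ℝ, (∀ i, 0 < w i) ∧ ∃ h : ∑ i, w i • G i ≠ 0,
        q = Projectivization.mk ℝ (∑ i, w i • G i) h} := by
  obtain ⟨hd, g, hg⟩ := hS
  have hd : 3 ≤ d := hd
  let e : Fin 3 → Fin d := Fin.castLE hd
  have he : Function.Injective e := Fin.castLE_injective hd
  refine ⟨fun i => g (Pi.single (e i) 1), ?_, ?_⟩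
  · have h1 : LinearIndependent ℝ (fun i : Fin d => (Pi.single i 1 : Fin d → ℝ)) :=
      Pi.linearIndependent_single_one (Fin d) ℝ
    have h2 := h1.comp e he
    exact h2.map' g.toLinearMap g.ker
  · have key : ∀ w : Fin 3 → ℝ, ∑ i, w i • g (Pi.single (e i) 1) =
        g (∑ i, w i • Pi.single (e i) 1) := by
      intro w; simp [map_sum]
    have val : ∀ w : Fin 3 → ℝ, ∀ j, (∑ i, w i • (Pi.single (e i) 1 : Fin d → ℝ)) (e j) = w j := by
      intro w j
      rw [Finset.sum_apply, Finset.sum_eq_single j]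
      · simp
      · intro b _ hb
        simp [Pi.single_apply, he.ne hb.symm]
      · simp
    have val0 : ∀ w : Fin 3 → ℝ, ∀ k : Fin d, 3 ≤ (k : ℕ) →
        (∑ i, w i • (Pi.single (e i) 1 : Fin d → ℝ)) k = 0 := by
      intro w k hk
      rw [Finset.sum_apply]
      refine Finset.sum_eq_zero fun i _ => ?_
      have : k ≠ e i := by
        intro h
        have h2 : (k : ℕ) = i := by rw [h]; rfl
        omega
      simp [Pi.single_apply, this]
    rw [hg]
    ext q
    constructor
    · rintro ⟨v, ⟨hv1, hv2⟩, hv, rfl⟩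
      have hveq : ∑ i, v (e i) • (Pi.single (e i) 1 : Fin d → ℝ) = v := by
        ext k
        by_cases hk : (k : ℕ) < 3
        · have : k = e ⟨k, hk⟩ := rfl
          rw [this, val (fun i => v (e i))]
        · rw [val0 (fun i => v (e i)) k (by omega), hv2 k (by omega)]
      have hG : ∑ i, v (e i) • g (Pi.single (e i) 1) = g v := by
        rw [key (fun i => v (e i)), hveq]
      refine ⟨fun i => v (e i), fun i => hv1 _ (by show (i : ℕ) < 3; exact i.2), ?_, ?_⟩
      · rw [hG]; simpa using hv
      · congr 1; exact hG.symm
    · rintro ⟨w, hw, h, rfl⟩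
      refine ⟨∑ i, w i • Pi.single (e i) 1, ⟨?_, ?_⟩, ?_, ?_⟩
      · intro k hk
        have : k = e ⟨k, hk⟩ := rfl
        rw [this, val]
        exact hw _
      · intro k hk
        exact val0 w k hk
      · intro h0
        apply h
        rw [key, h0, map_zero]
      · congr 1; exact key w

/-- Description of a simplex and its closure in an affine chart. -/
lemma simplex_chart {S : Set (PSpace d)} (hS : IsSimplexOfDim 2 S) {f : (Fin d → ℝ) →ₗ[ℝ] ℝ}
    (hf : ∀ x ∈ closure S, f x.rep ≠ 0) :
    ∃ u : Fin 3 → (Fin d → ℝ), LinearIndependent ℝ u ∧ (∀ i, f (u i) = 1) ∧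
      (∀ x, f x.rep ≠ 0 → (x ∈ S ↔ ∃ w : Fin 3 → ℝ, (∀ i, 0 < w i) ∧ ∑ i, w i = 1 ∧
        chartMap f x = ∑ i, w i • u i)) ∧
      (∀ x, f x.rep ≠ 0 → (x ∈ closure S ↔ ∃ w : Fin 3 → ℝ, (∀ i, 0 ≤ w i) ∧ ∑ i, w i = 1 ∧
        chartMap f x = ∑ i, w i • u i)) := by
  obtain ⟨G, hG, hSG⟩ := exists_G hS
  have nz : ∀ w : Fin 3 → ℝ, (∃ i, w i ≠ 0) → ∑ i, w i • G i ≠ 0 := by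
    rintro w ⟨i, hi⟩ h
    exact hi (Fintype.linearIndependent_iff.1 hG w h i)
  -- nonnegative combinations are in the closure
  have clS : ∀ w : Fin 3 → ℝ, (∀ i, 0 ≤ w i) → ∀ h : ∑ i, w i • G i ≠ 0,
      Projectivization.mk ℝ (∑ i, w i • G i) h ∈ closure S := by
    intro w hw h
    refine mk_mem_closure (A := (fun w : Fin 3 → ℝ => ∑ i, w i • G i) '' {w | ∀ i, 0 < w i})
      ?_ h ?_
    · rintro _ ⟨w', hw', rfl⟩
      have := nz w' ⟨0, (hw' 0).ne'⟩
      refine ⟨this, ?_⟩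
      rw [hSG]
      exact ⟨w', hw', this, rfl⟩
    · have hc : Continuous (fun w : Fin 3 → ℝ => ∑ i, w i • G i) := by fun_prop
      refine mem_closure_image (f := fun w : Fin 3 → ℝ => ∑ i, w i • G i) hc.continuousAt ?_
      have ht : Tendsto (fun n : ℕ => w + fun _ => (1 / ((n : ℝ) + 1))) atTop (nhds w) := by
        have : Tendsto (fun n : ℕ => (fun _ : Fin 3 => (1 / ((n : ℝ) + 1)))) atTop (nhds 0) :=
          tendsto_pi_nhds.2 fun i => tendsto_one_div_add_atTop_nhds_zero_nat
        simpa using tendsto_const_nhds.add this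
      refine mem_closure_of_tendsto ht (Eventually.of_forall fun n i => ?_)
      have := hw i
      simp only [Pi.add_apply]
      positivity
  have fne : ∀ w : Fin 3 → ℝ, (∀ i, 0 ≤ w i) → (∃ i, w i ≠ 0) → f (∑ i, w i • G i) ≠ 0 := by
    intro w hw hi
    exact (f_rep_mk f _ (nz w hi)).1 (hf _ (clS w hw (nz w hi)))
  -- constancy of the sign
  have sg : ∀ i j, 0 < f (G i) * f (G j) := by
    intro i j
    refine sign_const (D := (fun w : Fin 3 → ℝ => ∑ i, w i • G i) '' stdSimplex ℝ (Fin 3))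
      ?_ f ?_ ?_ ?_
    · have := (convex_stdSimplex ℝ (Fin 3)).linear_image (Fintype.linearCombination ℝ G)
      exact this
    · rintro _ ⟨w, hw, rfl⟩
      refine fne w hw.1 ?_
      by_contra! hc
      have := hw.2
      simp [hc] at this
    · exact ⟨Pi.single i 1, single_mem_stdSimplex ℝ i, by simp [Pi.single_apply]⟩
    · exact ⟨Pi.single j 1, single_mem_stdSimplex ℝ j, by simp [Pi.single_apply]⟩
  have gne : ∀ i, f (G i) ≠ 0 := fun i h => by simpa [h] using sg i i
  set u : Fin 3 → (Fin d → ℝ) := fun i => (f (G i))⁻¹ • G i with hu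
  have hfu : ∀ i, f (u i) = 1 := fun i => by simp [hu, gne i]
  have hsumu : ∀ w : Fin 3 → ℝ, f (∑ i, w i • u i) = ∑ i, w i := by
    intro w; simp [map_sum, hfu]
  have fG : ∀ w : Fin 3 → ℝ, f (∑ i, w i • G i) = ∑ i, w i * f (G i) := by
    intro w; simp [map_sum]
  have Gu : ∀ w : Fin 3 → ℝ, ∑ i, w i • G i = ∑ i, (w i * f (G i)) • u i := by
    intro w
    refine Finset.sum_congr rfl fun i _ => ?_
    rw [hu, smul_smul, mul_assoc, mul_inv_cancel₀ (gne i), mul_one]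
  have uG : ∀ w : Fin 3 → ℝ, f (G 0) • ∑ i, w i • u i = ∑ i, (w i * (f (G 0) / f (G i))) • G i := by
    intro w
    rw [Finset.smul_sum]
    refine Finset.sum_congr rfl fun i _ => ?_
    rw [hu]
    module
  have rpos : ∀ i, 0 < f (G 0) / f (G i) := by
    intro i
    have := sg 0 i
    rcases mul_pos_iff.1 this with ⟨_, _⟩ | ⟨_, _⟩
    · positivity
    · exact div_pos_of_neg_of_neg ‹_› ‹_›
  have mkeq : ∀ w : Fin 3 → ℝ, ∑ i, w i = 1 → ∀ x : PSpace d, f x.rep ≠ 0 →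
      chartMap f x = ∑ i, w i • u i →
      ∃ h : ∑ i, (w i * (f (G 0) / f (G i))) • G i ≠ 0,
        x = Projectivization.mk ℝ (∑ i, (w i * (f (G 0) / f (G i))) • G i) h := by
    intro w hw x hx hxe
    have h0 : ∑ i, w i • u i ≠ 0 := ne_zero_of_f (f := f) (by rw [hsumu, hw])
    have h1 : ∑ i, (w i * (f (G 0) / f (G i))) • G i ≠ 0 := by
      rw [← uG]; exact smul_ne_zero (gne 0) h0
    refine ⟨h1, ?_⟩
    rw [← mk_chartMap hx (ne_zero_of_f (f_chartMap hx)), eq_comm, Projectivization.mk_eq_mk_iff']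
    exact ⟨f (G 0), by rw [hxe, uG]⟩
  have hSiff : ∀ x, f x.rep ≠ 0 → (x ∈ S ↔ ∃ w : Fin 3 → ℝ, (∀ i, 0 < w i) ∧ ∑ i, w i = 1 ∧
        chartMap f x = ∑ i, w i • u i) := by
    intro x hx
    constructor
    · intro hxS
      rw [hSG] at hxS
      obtain ⟨w, hw, h, rfl⟩ := hxS
      have hs : f (∑ i, w i • G i) ≠ 0 := (f_rep_mk f _ h).1 hx
      refine ⟨fun i => (f (∑ i, w i • G i))⁻¹ * (w i * f (G i)), ?_, ?_, ?_⟩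
      · intro i
        have h1 : 0 < f (G i) * f (∑ j, w j • G j) := by
          rw [fG, Finset.mul_sum]
          refine Finset.sum_pos (fun j _ => ?_) ⟨0, Finset.mem_univ _⟩
          have := mul_pos (hw j) (sg i j)
          linarith
        have h2 : 0 < (f (∑ j, w j • G j))⁻¹ * f (G i) := by
          rw [← div_eq_inv_mul]
          rcases mul_pos_iff.1 h1 with ⟨_, _⟩ | ⟨_, _⟩
          · positivity
          · exact div_pos_of_neg_of_neg ‹_› ‹_›
        have := mul_pos (hw i) h2
        linarith
      · rw [← Finset.mul_sum, ← fG, inv_mul_cancel₀ hs]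
      · rw [chartMap_mk]
        simp_rw [← smul_smul _ (_ * _), ← Finset.smul_sum, ← Gu]
    · rintro ⟨w, hw, hw1, hxe⟩
      obtain ⟨h, he⟩ := mkeq w hw1 x hx hxe
      rw [hSG]
      exact ⟨_, fun i => mul_pos (hw i) (rpos i), h, he⟩
  refine ⟨u, ?_, hfu, hSiff, ?_⟩
  · have := hG.units_smul (fun i => Units.mk0 _ (inv_ne_zero (gne i)))
    exact this
  · intro x hx
    constructor
    · intro hxS
      have hc : IsCompact ((fun w : Fin 3 → ℝ => ∑ i, w i • u i) '' stdSimplex ℝ (Fin 3)) :=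
        (isCompact_stdSimplex ℝ (Fin 3)).image (by fun_prop)
      have h1 : chartMap f x ∈ closure (chartMap f '' S) :=
        mem_closure_image (chartMap_continuousAt hx) hxS
      have h2 : chartMap f x ∈ (fun w : Fin 3 → ℝ => ∑ i, w i • u i) '' stdSimplex ℝ (Fin 3) := by
        refine closure_minimal ?_ hc.isClosed h1
        rintro _ ⟨y, hy, rfl⟩
        obtain ⟨w, hw, hw1, he⟩ := (hSiff y (hf y (subset_closure hy))).1 hy
        exact ⟨w, ⟨fun i => (hw i).le, hw1⟩, he.symm⟩
      obtain ⟨w, hw, he⟩ := h2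
      exact ⟨w, hw.1, hw.2, he.symm⟩
    · rintro ⟨w, hw, hw1, hxe⟩
      obtain ⟨h, he⟩ := mkeq w hw1 x hx hxe
      rw [he]
      exact clS _ (fun i => mul_nonneg (hw i) (rpos i).le) h

end simplex

section faces

lemma mem_face_iff {Ω : Set (PSpace d)} (hΩ : IsProperlyConvex Ω) {x y : PSpace d}
    (hx : x ∈ closure Ω) : y ∈ face Ω x ↔
      y ∈ closure Ω ∧ cmap Ω y ∈ Fc (cmap Ω '' closure Ω) (cmap Ω x) := by
  have hD := convex_D hΩ
  constructor
  · rintro (rfl | ⟨hy, a, ha, b, hb, hxs, hys⟩)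
    · exact ⟨hx, self_mem_Fc (mem_image_of_mem _ hx)⟩
    · exact ⟨hy, Fc_of_seg hD (mem_image_of_mem _ ha) (mem_image_of_mem _ hb) hxs.2 hys.2⟩
  · rintro ⟨hy, hF⟩
    obtain ⟨_, ⟨a, ha, rfl⟩, _, ⟨b, hb, rfl⟩, h1, h2⟩ := seg_of_Fc hF
    exact Or.inr ⟨hy, a, ha, b, hb, ⟨hx, h1⟩, ⟨hy, h2⟩⟩

lemma face_image {Ω : Set (PSpace d)} (hΩ : IsProperlyConvex Ω) {x : PSpace d}
    (hx : x ∈ closure Ω) : cmap Ω '' face Ω x = Fc (cmap Ω '' closure Ω) (cmap Ω x) := by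
  ext Y
  constructor
  · rintro ⟨y, hy, rfl⟩
    exact ((mem_face_iff hΩ hx).1 hy).2
  · intro hY
    obtain ⟨y, hy, rfl⟩ := hY.1
    exact ⟨y, (mem_face_iff hΩ hx).2 ⟨hy, hY⟩, rfl⟩

lemma face_pc {Ω : Set (PSpace d)} (hΩ : IsProperlyConvex Ω) {x : PSpace d}
    (hx : x ∈ closure Ω) : IsProperlyConvex (face Ω x) := by
  obtain ⟨h1, h2, h3⟩ := chartOf_spec hΩ
  have hsub : face Ω x ⊆ closure Ω := fun y hy => ((mem_face_iff hΩ hx).1 hy).1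
  refine ⟨chartOf Ω, fun y hy => h1 y (closure_minimal hsub isClosed_closure hy), ?_, ?_⟩
  · have := face_image hΩ hx
    change Convex ℝ (cmap Ω '' face Ω x)
    rw [this]
    exact Fc_convex (convex_D hΩ) (mem_image_of_mem _ hx)
  · refine h3.closure.subset ?_
    have := chart_image_closure h1
    change _ ⊆ closure (chartMap (chartOf Ω) '' Ω)
    rw [← this]
    exact image_mono hsub

lemma pdim_ge {F : Set (PSpace d)} (hF : IsProperlyConvex F) (p : Fin 3 → PSpace d)
    (hp : ∀ i, p i ∈ F) (hl : LinearIndependent ℝ (fun i => (p i).rep)) : 2 ≤ pdim F := by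
  obtain ⟨h1, -, -⟩ := chartOf_spec hF
  have hl2 : LinearIndependent ℝ (fun i => cmap F (p i)) :=
    hl.units_smul (fun i => Units.mk0 _ (inv_ne_zero (h1 _ (subset_closure (hp i)))))
  have ha := hl2.affineIndependent.finrank_vectorSpan (n := 2) (by simp)
  unfold pdim pdimIn
  rw [direction_affineSpan, ← ha]
  apply Submodule.finrank_mono
  apply vectorSpan_mono
  rintro _ ⟨i, rfl⟩
  exact mem_image_of_mem _ (hp i)

end faces

/-- Lemma 6.4: under the assumption that all boundary faces meeting
`closure C_Ω(Λ)` have dimension at most one, the boundary of a properly embedded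
two-dimensional simplex in `C_Ω(Λ)` is a union of open faces of `Ω`. -/
theorem simplex_boundary_is_union_of_faces {d : ℕ} (T : CCSetup d)
    (hdim : ∀ x ∈ closure T.Ω \ T.Ω, (face T.Ω x ∩ closure (coreC T.Ω T.Λ)).Nonempty →
      pdim (face T.Ω x) ≤ 1)
    (S : Set (PSpace d)) (hS : IsSimplexOfDim 2 S) (hSsub : S ⊆ coreC T.Ω T.Λ)
    (hSpe : IsProperlyEmbedded S (coreC T.Ω T.Λ)) :
    closure S \ S = ⋃ x ∈ closure S \ S, face T.Ω x := by
  have hΩ := T.properlyConvex_Ω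
  obtain ⟨h1, -, -⟩ := chartOf_spec hΩ
  have hSΩ : closure S ⊆ closure T.Ω := closure_mono fun y hy => (hSsub hy).1
  obtain ⟨u, hul, hfu, hSi, hSc⟩ := simplex_chart hS (f := chartOf T.Ω)
    (fun x hx => h1 x (hSΩ hx))
  -- membership in the boundary in terms of the chart
  have bd : ∀ x ∈ closure T.Ω, (x ∈ closure S \ S ↔ cmap T.Ω x ∈ Bd u) := by
    intro x hx
    have hfx := h1 x hx
    constructor
    · rintro ⟨hc, hn⟩
      obtain ⟨w, hw, hw1, he⟩ := (hSc x hfx).1 hc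
      refine ⟨w, hw, hw1, ?_, he⟩
      by_contra! h0
      exact hn ((hSi x hfx).2 ⟨w, fun i => lt_of_le_of_ne (hw i) (h0 i).symm, hw1, he⟩)
    · rintro ⟨w, hw, hw1, ⟨i, hi⟩, he⟩
      refine ⟨(hSc x hfx).2 ⟨w, hw, hw1, he⟩, fun hxS => ?_⟩
      obtain ⟨w', hw', -, he'⟩ := (hSi x hfx).1 hxS
      have h0 : ∑ i, (w i - w' i) • u i = 0 := by
        simp_rw [sub_smul, Finset.sum_sub_distrib]
        rw [← he', ← he]
        exact sub_self _
      have := Fintype.linearIndependent_iff.1 hul _ h0 i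
      have := hw' i
      linarith
  have inD : ∀ X ∈ Bd u, ∃ x ∈ closure S, cmap T.Ω x = X := by
    rintro X ⟨w, hw, hw1, -, rfl⟩
    have hf1 : chartOf T.Ω (∑ i, w i • u i) = 1 := by simp [map_sum, hfu, hw1]
    have hch : chartMap (chartOf T.Ω) (Projectivization.mk ℝ _ (ne_zero_of_f hf1)) =
        ∑ i, w i • u i := by
      rw [chartMap_mk, hf1]; simp
    refine ⟨Projectivization.mk ℝ _ (ne_zero_of_f hf1), ?_, hch⟩
    refine (hSc _ ?_).2 ⟨w, hw, hw1, hch⟩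
    rw [f_rep_mk, hf1]
    exact one_ne_zero
  have huD : ∀ i, u i ∈ cmap T.Ω '' closure T.Ω := by
    intro i
    obtain ⟨j, hj⟩ : ∃ j : Fin 3, i ≠ j := ⟨i + 1, by revert i; decide⟩
    have := seg_mem_Bd u hj (s := 1) (t := 0) (by norm_num) le_rfl (by norm_num)
    obtain ⟨x, hx, he⟩ := inD _ this
    exact ⟨x, hSΩ hx, by simpa using he⟩
  have H : ∀ X ∈ Bd u, ∀ P ∈ Fc (cmap T.Ω '' closure T.Ω) X, ∀ Q ∈ Fc (cmap T.Ω '' closure T.Ω) X,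
      ∀ R ∈ Fc (cmap T.Ω '' closure T.Ω) X, ¬ LinearIndependent ℝ ![P, Q, R] := by
    intro X hX P hP Q hQ R hR hli
    obtain ⟨x, hxS, rfl⟩ := inD X hX
    have hx := hSΩ hxS
    have hxb := (bd x hx).2 hX
    rw [← face_image hΩ hx] at hP hQ hR
    obtain ⟨p, hp, rfl⟩ := hP
    obtain ⟨q, hq, rfl⟩ := hQ
    obtain ⟨r, hr, rfl⟩ := hR
    have hle := hdim x (bdry_sub T hSsub hSpe hxb)
      ⟨x, Set.mem_insert _ _, closure_mono hSsub hxS⟩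
    have hcl : ∀ y ∈ face T.Ω x, chartOf T.Ω y.rep ≠ 0 := fun y hy =>
      h1 y ((mem_face_iff hΩ hx).1 hy).1
    have hmem : ∀ i, ![p, q, r] i ∈ face T.Ω x := by
      intro i; fin_cases i <;> assumption
    have hge := pdim_ge (face_pc hΩ hx) ![p, q, r] hmem (by
      have := hli.units_smul (fun i => Units.mk0 _ (hcl _ (hmem i)))
      convert this using 1
      ext1 i
      have e : ![cmap T.Ω p, cmap T.Ω q, cmap T.Ω r] i = cmap T.Ω (![p, q, r] i) := by
        fin_cases i <;> rfl
      simp only [Pi.smul_apply', Units.smul_def, Units.val_mk0]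
      rw [e, cmap, chartMap, smul_smul, mul_inv_cancel₀ (hcl _ (hmem i)), one_smul])
    omega
  apply Subset.antisymm
  · intro x hx
    exact mem_iUnion₂.2 ⟨x, hx, Set.mem_insert _ _⟩
  · refine iUnion₂_subset fun x hx y hy => ?_
    have hxΩ := hSΩ hx.1
    obtain ⟨hyΩ, hyF⟩ := (mem_face_iff hΩ hxΩ).1 hy
    refine (bd y hyΩ).2 (Bd_union (convex_D hΩ) (f := chartOf T.Ω) ?_ hul huD H
      ((bd x hxΩ).1 hx) hyF)
    rintro _ ⟨z, hz, rfl⟩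
    exact f_chartMap (h1 z hz)

end Paper
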